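/- arXiv:2509.01368 — 6 statements merged into one kernel-verified Lean document; each statement's English description precedes it below -/
import Mathlib

section
/- Let ν, λ, r : ℝ² → ℝ be C¹ functions of (t, x) with r > 0 everywhere, denote partial derivatives by subscripts (ν_t, ν_x, λ_t, λ_x, r_t, r_x), let I ⊆ ℝ be an interval and x : I → ℝ twice differentiable, and define y(t) = e^{λ(t,x(t)) − ν(t,x(t))} x′(t). Then x satisfies the second-order equation x″ = e^{2(ν−λ)}(r_x − r ν_x)/r + x′(r_t/r − 2λ_t + ν_t) + x′²(−r_x/r − λ_x + 2ν_x) + x′³ e^{2(λ−ν)}(r λ_t − r_t)/r (all coefficients evaluated at (t, x(t))) if and only if the pair (x, y) satisfies the first-order system x′(t) = e^{ν−λ} y(t) and y′(t) = (1 − y(t)²)·[e^{ν−λ}(r_x − r ν_x) + y(t)(r_t − r λ_t)]/r (evaluated at (t, x(t))). -/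
/-- Chain rule along a graph `s ↦ (s, x s)`, in terms of the partial derivatives. -/
theorem hasDerivAt_along_graph {f : ℝ → ℝ → ℝ} {x : ℝ → ℝ} {t ft fx x' : ℝ}
    (hf : DifferentiableAt ℝ (fun p : ℝ × ℝ => f p.1 p.2) (t, x t))
    (hft : HasDerivAt (fun s => f s (x t)) ft t)
    (hfx : HasDerivAt (fun s => f t s) fx (x t))
    (hx : HasDerivAt x x' t) :
    HasDerivAt (fun s => f s (x s)) (ft + fx * x') t := by
  obtain ⟨L, hL⟩ := hf
  have h₁ : ft = L (1, 0) := hft.unique <|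
    HasFDerivAt.comp_hasDerivAt (f := fun s => (s, x t)) t hL
      ((hasDerivAt_id t).prodMk (hasDerivAt_const t (x t)))
  have h₂ : fx = L (0, 1) := hfx.unique <|
    HasFDerivAt.comp_hasDerivAt (f := fun s => (t, s)) (x t) hL
      ((hasDerivAt_const (x t) t).prodMk (hasDerivAt_id (x t)))
  have h₃ : HasDerivAt (fun s => f s (x s)) (L (1, x')) t :=
    HasFDerivAt.comp_hasDerivAt (f := fun s => (s, x s)) t hL ((hasDerivAt_id t).prodMk hx)
  have h₄ : L (1, x') = ft + fx * x' := by
    have : ((1, x') : ℝ × ℝ) = (1, 0) + x' • (0, 1) := by simp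
    rw [this, map_add, map_smul, ← h₁, ← h₂, smul_eq_mul, mul_comm]
  exact h₄ ▸ h₃


/-- Equivalence between the second-order photon-surface ODE in a general
spherically symmetric spacetime and the first-order system (2.3)-(2.4). -/
theorem stmt_1
    (ν lam r : ℝ → ℝ → ℝ)
    (hν : ContDiff ℝ 1 (fun p : ℝ × ℝ => ν p.1 p.2))
    (hlam : ContDiff ℝ 1 (fun p : ℝ × ℝ => lam p.1 p.2))
    (hr : ContDiff ℝ 1 (fun p : ℝ × ℝ => r p.1 p.2))
    (hrpos : ∀ t x, 0 < r t x)
    (νt νx lamt lamx rt rx : ℝ → ℝ → ℝ)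
    (hνt : ∀ t x, HasDerivAt (fun s => ν s x) (νt t x) t)
    (hνx : ∀ t x, HasDerivAt (fun s => ν t s) (νx t x) x)
    (hlamt : ∀ t x, HasDerivAt (fun s => lam s x) (lamt t x) t)
    (hlamx : ∀ t x, HasDerivAt (fun s => lam t s) (lamx t x) x)
    (hrt : ∀ t x, HasDerivAt (fun s => r s x) (rt t x) t)
    (hrx : ∀ t x, HasDerivAt (fun s => r t s) (rx t x) x)
    (I : Set ℝ) (hI : I.OrdConnected)
    (x : ℝ → ℝ)
    (hx1 : ∀ t ∈ I, DifferentiableAt ℝ x t)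
    (hx2 : ∀ t ∈ I, DifferentiableAt ℝ (deriv x) t)
    (y : ℝ → ℝ)
    (hy : ∀ t, y t = Real.exp (lam t (x t) - ν t (x t)) * deriv x t) :
    ((∀ t ∈ I, deriv (deriv x) t =
        Real.exp (2 * (ν t (x t) - lam t (x t))) *
            (rx t (x t) - r t (x t) * νx t (x t)) / r t (x t)
        + deriv x t * (rt t (x t) / r t (x t) - 2 * lamt t (x t) + νt t (x t))
        + (deriv x t) ^ 2 *
            (-(rx t (x t) / r t (x t)) - lamx t (x t) + 2 * νx t (x t))
        + (deriv x t) ^ 3 * Real.exp (2 * (lam t (x t) - ν t (x t))) *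
            (r t (x t) * lamt t (x t) - rt t (x t)) / r t (x t))
      ↔
      (∀ t ∈ I, deriv x t = Real.exp (ν t (x t) - lam t (x t)) * y t ∧
        deriv y t = (1 - (y t) ^ 2) *
          (Real.exp (ν t (x t) - lam t (x t)) * (rx t (x t) - r t (x t) * νx t (x t))
            + y t * (rt t (x t) - r t (x t) * lamt t (x t))) / r t (x t))) := by
  refine forall₂_congr fun t ht => ?_
  have hx := (hx1 t ht).hasDerivAt
  have hνd := hasDerivAt_along_graph (hν.differentiable one_ne_zero _)
    (hνt t (x t)) (hνx t (x t)) hx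
  have hlamd := hasDerivAt_along_graph (hlam.differentiable one_ne_zero _)
    (hlamt t (x t)) (hlamx t (x t)) hx
  have hyd := ((hlamd.sub hνd).exp.mul (hx2 t ht).hasDerivAt).deriv
  have hy' : y = (fun s => Real.exp (lam s (x s) - ν s (x s))) * deriv x := funext hy
  have hexp : Real.exp (lam t (x t) - ν t (x t)) = (Real.exp (ν t (x t) - lam t (x t)))⁻¹ := by
    rw [← Real.exp_neg, neg_sub]
  have hsq : Real.exp (2 * (ν t (x t) - lam t (x t)))
      = Real.exp (ν t (x t) - lam t (x t)) ^ 2 := by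
    rw [← Real.exp_nat_mul, Nat.cast_ofNat]
  have hsq' : Real.exp (2 * (lam t (x t) - ν t (x t)))
      = (Real.exp (ν t (x t) - lam t (x t)))⁻¹ ^ 2 := by
    rw [← hexp, ← Real.exp_nat_mul, Nat.cast_ofNat]
  have hE := Real.exp_ne_zero (ν t (x t) - lam t (x t))
  have hr0 := (hrpos t (x t)).ne'
  have hdy : deriv y t = _ := (congrArg (deriv · t) hy').trans hyd
  simp only [Pi.sub_apply] at hdy
  rw [hdy, hy t, hexp, hsq, hsq', mul_inv_cancel_left₀ hE, eq_self_iff_true, true_and]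
  generalize Real.exp (ν t (x t) - lam t (x t)) = E at *
  rw [← sub_eq_zero, ← mul_eq_zero_iff_left (inv_ne_zero hE), ← sub_eq_zero (b := _ / _)]
  refine Eq.congr ?_ rfl
  field_simp
  ring
end

section
/- Let μ : (0,∞) → (0,∞) be a C¹ function, and define r(t,x) = x(1 − μ(x) t)^{2/3} for t < t_s(x) := 1/μ(x), with r_x its partial derivative in x, and t_h(x) = (1/μ(x))(1 − (8/27) μ(x)³ x³). Then for every x > 0 one has the identity r_x(t_h(x), x) − t_h′(x) = (4/9) x² μ(x) (3 μ(x) + 2 x μ′(x)). In particular, if 3μ(x) + 2xμ′(x) ≥ 0 for all x > 0 (equivalently, the Misner–Sharp mass m(x) = (2/9)μ(x)²x³ is nondecreasing), then t_h is a subsolution of the outgoing radial null geodesic equation: t_h′(x) ≤ r_x(t_h(x), x) for all x > 0. -/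
theorem Real.cube_rpow_two_thirds {v : ℝ} (hv : 0 < v) : (v ^ 3) ^ ((2 : ℝ) / 3) = v ^ 2 := by
  rw [← Real.rpow_natCast v 3, ← Real.rpow_mul hv.le, ← Real.rpow_natCast v 2]
  norm_num

theorem Real.cube_rpow_two_thirds_sub_one {v : ℝ} (hv : 0 < v) :
    (v ^ 3) ^ ((2 : ℝ) / 3 - 1) = v⁻¹ := by
  rw [← Real.rpow_natCast v 3, ← Real.rpow_mul hv.le, ← Real.rpow_neg_one]
  norm_num

/-- The derivative of the apparent horizon curve. -/
theorem hasDerivAt_apparentHorizon {μ : ℝ → ℝ} {μ' x : ℝ} (hμ : HasDerivAt μ μ' x)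
    (h0 : μ x ≠ 0) :
    HasDerivAt (fun y => (1 / μ y) * (1 - 8 / 27 * (μ y) ^ 3 * y ^ 3))
      (-μ' / μ x ^ 2 - 16 / 27 * μ x * μ' * x ^ 3 - 8 / 9 * μ x ^ 2 * x ^ 2) x := by
  have h := (((hasDerivAt_const x (1 : ℝ)).div hμ h0)).mul
    ((hasDerivAt_const x (1 : ℝ)).sub
      (((hμ.pow 3).const_mul (8 / 27 : ℝ)).mul ((hasDerivAt_id x).pow 3)))
  refine h.congr_deriv ?_
  simp
  field_simp
  ring

/-- The derivative in `x` of the areal radius, where `1 - μ x * t` is the cube of `v > 0`. -/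
theorem hasDerivAt_arealRadius {μ : ℝ → ℝ} {μ' t v x : ℝ} (hμ : HasDerivAt μ μ' x)
    (hv : 0 < v) (hu : 1 - μ x * t = v ^ 3) :
    HasDerivAt (fun y => y * (1 - μ y * t) ^ ((2 : ℝ) / 3))
      (v ^ 2 - 2 / 3 * x * μ' * t / v) x := by
  have hne : 1 - μ x * t ≠ 0 := by rw [hu]; positivity
  have h := (hasDerivAt_id x).mul
    (((hμ.mul_const t).const_sub 1).rpow_const (p := (2 : ℝ) / 3) (Or.inl hne))
  refine h.congr_deriv ?_
  rw [hu, Real.cube_rpow_two_thirds hv, Real.cube_rpow_two_thirds_sub_one hv]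
  simp only [id]
  ring

/-- The identity `r_x(t_h(x),x) - t_h'(x) = (4/9) x² μ(x) (3μ(x) + 2xμ'(x))`;
in particular, if the Misner–Sharp mass is nondecreasing
(`3μ + 2xμ' ≥ 0`), the apparent horizon `t_h` is a subsolution of the
outgoing radial null geodesic equation `t' = r_x(t,x)`. -/
theorem stmt_6 (μ : ℝ → ℝ) (hμpos : ∀ x > 0, 0 < μ x)
    (hμC1 : ContDiffOn ℝ 1 μ (Set.Ioi 0))
    (r : ℝ → ℝ → ℝ)
    (hr : ∀ t x, r t x = x * (1 - μ x * t) ^ ((2 : ℝ) / 3))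
    (ts th : ℝ → ℝ)
    (hts : ∀ x, ts x = 1 / μ x)
    (hth : ∀ x, th x = (1 / μ x) * (1 - 8 / 27 * (μ x) ^ 3 * x ^ 3)) :
    (∀ x > 0, deriv (fun x' => r (th x) x') x - deriv th x =
      4 / 9 * x ^ 2 * μ x * (3 * μ x + 2 * x * deriv μ x)) ∧
    ((∀ x > 0, 0 ≤ 3 * μ x + 2 * x * deriv μ x) →
      ∀ x > 0, deriv th x ≤ deriv (fun x' => r (th x) x') x) := by
  have key : ∀ x > 0, deriv (fun x' => r (th x) x') x - deriv th x =
      4 / 9 * x ^ 2 * μ x * (3 * μ x + 2 * x * deriv μ x) := by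
    intro x hx
    have hp := hμpos x hx
    have hμ : HasDerivAt μ (deriv μ x) x :=
      ((hμC1.differentiableOn one_ne_zero).differentiableAt (Ioi_mem_nhds hx)).hasDerivAt
    have hu : 1 - μ x * th x = (2 / 3 * μ x * x) ^ 3 := by
      rw [hth]
      field_simp
      ring
    have hv : 0 < 2 / 3 * μ x * x := by positivity
    rw [show (fun x' => r (th x) x') = _ from funext (hr (th x)),
      (hasDerivAt_arealRadius hμ hv hu).deriv, hth x, funext hth,
      (hasDerivAt_apparentHorizon hμ hp.ne').deriv]
    field_simp
    ring
  refine ⟨key, fun hm x hx => ?_⟩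
  have hp := hμpos x hx
  have hd : 0 ≤ 4 / 9 * x ^ 2 * μ x * (3 * μ x + 2 * x * deriv μ x) :=
    mul_nonneg (by positivity) (hm x hx)
  linarith [key x hx]
end

section
/- Fix an integer n and a > 0 with either n ∈ {1, 2}, or n = 3 and a > 2(26 + 15√3)/27, and set μ(x) = 1 − a xⁿ. Then there exist ξ ∈ (0, a) and x̄ > 0 such that for every x ∈ (0, x̄]: (i) 1 + ξ xⁿ < t_h(x) < t_s(x), and (ii) the curve t_ξ(x) = 1 + ξ xⁿ is a supersolution of the outgoing radial null geodesic equation, i.e. n ξ x^{n−1} ≥ r_x(1 + ξ xⁿ, x). -/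
open Filter Topology in
/-- If the rescaled area-radius gradient along `1 + ξ xⁿ` has limit below `n ξ` at the centre and
the curve starts below the apparent horizon, both inequalities persist near the centre. -/
lemma exists_gradient_and_horizon_bound (n : ℕ) (hn : n ≤ 3) (hn1 : 1 ≤ n) (a ξ : ℝ) (hξa : ξ < a)
    (hhor : 8 / 27 * (0 : ℝ) ^ (3 - n) < a - ξ)
    (hgrad : (0 : ℝ) ^ ((3 - n : ℝ) / 3) *
      ((a - ξ) ^ (-(1 / 3) : ℝ) * ((a - ξ) + 2 / 3 * a * n)) < n * ξ) :
    ∃ xbar > 0, ∀ x : ℝ, 0 < x → x ≤ xbar → a * x ^ n < 1 ∧ 8 / 27 * x ^ (3 - n) < a - ξ ∧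
      x ^ ((3 - n : ℝ) / 3) * ((a - ξ + a * ξ * x ^ n) ^ (-(1 / 3) : ℝ) *
        ((a - ξ + a * ξ * x ^ n) + 2 / 3 * a * n * (1 + ξ * x ^ n))) < n * ξ := by
  have hn' : (n : ℝ) ≤ 3 := by exact_mod_cast hn
  have hn0 : n ≠ 0 := by lia
  have e1 : ∀ᶠ x : ℝ in 𝓝 0, a * x ^ n < 1 := by
    have hc : ContinuousAt (fun x : ℝ => a * x ^ n) 0 := by fun_prop
    exact hc.eventually_lt continuousAt_const (by simp [hn0])
  have e2 : ∀ᶠ x : ℝ in 𝓝 0, 8 / 27 * x ^ (3 - n) < a - ξ := by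
    have hc : ContinuousAt (fun x : ℝ => 8 / 27 * x ^ (3 - n)) 0 := by fun_prop
    exact hc.eventually_lt continuousAt_const hhor
  have e3 : ∀ᶠ x : ℝ in 𝓝 0, x ^ ((3 - n : ℝ) / 3) *
      ((a - ξ + a * ξ * x ^ n) ^ (-(1 / 3) : ℝ) *
        ((a - ξ + a * ξ * x ^ n) + 2 / 3 * a * n * (1 + ξ * x ^ n))) < n * ξ := by
    have hw : ContinuousAt (fun x : ℝ => a - ξ + a * ξ * x ^ n) 0 := by fun_prop
    have hc := (Real.continuousAt_rpow_const 0 ((3 - n : ℝ) / 3) (Or.inr (by linarith))).mul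
      ((hw.rpow_const (p := -(1 / 3)) (Or.inl (by simp [hn0]; linarith))).mul
        (hw.add (by fun_prop : ContinuousAt (fun x : ℝ => 2 / 3 * a * n * (1 + ξ * x ^ n)) 0)))
    exact hc.eventually_lt continuousAt_const (by simpa [hn0] using hgrad)
  obtain ⟨ε, hε, h⟩ := Metric.eventually_nhds_iff.1 (e1.and (e2.and e3))
  refine ⟨ε / 2, by positivity, fun x hx hxε => h ?_⟩
  rw [Real.dist_eq, sub_zero, abs_of_pos hx]
  linarith

lemma exists_initial_slope (n : ℕ) (a : ℝ) (ha : 0 < a)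
    (hcase : n = 1 ∨ n = 2 ∨ (n = 3 ∧ a > 2 * (26 + 15 * Real.sqrt 3) / 27)) :
    ∃ ξ : ℝ, 0 < ξ ∧ ξ < a ∧ 8 / 27 * (0 : ℝ) ^ (3 - n) < a - ξ ∧
      (0 : ℝ) ^ ((3 - n : ℝ) / 3) *
        ((a - ξ) ^ (-(1 / 3) : ℝ) * ((a - ξ) + 2 / 3 * a * n)) < n * ξ := by
  rcases hcase with rfl | rfl | ⟨rfl, h⟩
  · refine ⟨a / 2, by linarith, by linarith, by norm_num; linarith, ?_⟩
    rw [Real.zero_rpow (by norm_num)]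
    push_cast
    linarith
  · refine ⟨a / 2, by linarith, by linarith, by norm_num; linarith, ?_⟩
    rw [Real.zero_rpow (by norm_num)]
    push_cast
    linarith
  · have hq : Real.sqrt 3 ^ 2 = 3 := Real.sq_sqrt (by norm_num)
    have hq1 : 1 < Real.sqrt 3 := by
      rw [Real.lt_sqrt] <;> norm_num
    obtain ⟨q, hqdef⟩ : ∃ q, q = Real.sqrt 3 := ⟨_, rfl⟩
    rw [← hqdef] at hq hq1 h
    obtain ⟨s, hs⟩ : ∃ s, s = (1 + q) / 3 := ⟨_, rfl⟩
    have hs0 : 0 < s := by rw [hs]; linarith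
    have hs3 : s ^ 3 = (10 + 6 * q) / 27 := by
      rw [hs]; linear_combination (3 + q) / 27 * hq
    have hpow : (s ^ 3) ^ (-(1 / 3) : ℝ) = s⁻¹ := by
      rw [← Real.rpow_natCast, ← Real.rpow_mul hs0.le, ← Real.rpow_neg_one]
      norm_num
    refine ⟨a - s ^ 3, by rw [hs3]; linarith, by linarith [pow_pos hs0 3], ?_, ?_⟩
    · rw [sub_sub_cancel, hs3]; norm_num; linarith
    · rw [sub_sub_cancel, hpow]
      have key : s ^ 3 + 2 * a < 3 * (a - s ^ 3) * s := by
        rw [hs3, hs]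
        nlinarith [mul_pos (sub_pos.2 h) (sub_pos.2 hq1)]
      norm_num
      rw [inv_mul_lt_iff₀ hs0]
      linarith

/-- In the naked-singularity parameter range (`n ∈ {1,2}`, or `n = 3` and
`a > 2(26+15√3)/27`), there exist `ξ ∈ (0,a)` and `x̄ > 0` such that on
`(0, x̄]` the curve `t_ξ(x) = 1 + ξ xⁿ` lies below the apparent horizon and
is a supersolution of the outgoing radial null geodesic equation. -/
theorem stmt_7 (n : ℕ) (a : ℝ) (ha : 0 < a)
    (hcase : n = 1 ∨ n = 2 ∨ (n = 3 ∧ a > 2 * (26 + 15 * Real.sqrt 3) / 27))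
    (μ : ℝ → ℝ) (hμ : ∀ x, μ x = 1 - a * x ^ n)
    (r : ℝ → ℝ → ℝ)
    (hr : ∀ t x, r t x = x * (1 - μ x * t) ^ ((2 : ℝ) / 3))
    (ts th : ℝ → ℝ)
    (hts : ∀ x, ts x = 1 / μ x)
    (hth : ∀ x, th x = (1 / μ x) * (1 - 8 / 27 * (μ x) ^ 3 * x ^ 3)) :
    ∃ ξ : ℝ, 0 < ξ ∧ ξ < a ∧ ∃ xbar > 0, ∀ x : ℝ, 0 < x → x ≤ xbar →
      (1 + ξ * x ^ n < th x ∧ th x < ts x) ∧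
      (n : ℝ) * ξ * x ^ (n - 1) ≥
        deriv (fun x' => r (1 + ξ * x ^ n) x') x := by
  obtain ⟨ξ, hξ, hξa, hhor, hgrad⟩ := exists_initial_slope n a ha hcase
  have hn1 : 1 ≤ n := by lia
  have hn3 : n ≤ 3 := by lia
  obtain ⟨xbar, hxbar, hb⟩ :=
    exists_gradient_and_horizon_bound n hn3 hn1 a ξ hξa hhor hgrad
  refine ⟨ξ, hξ, hξa, xbar, hxbar, fun x hx hxb => ?_⟩
  obtain ⟨hμx, hx3, hF⟩ := hb x hx hxb
  have hy : 0 < x ^ n := pow_pos hx n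
  have hxpow : x ^ 3 = x ^ n * x ^ (3 - n) := by rw [← pow_add]; congr 1; lia
  set y := x ^ n with hydef
  set w := a - ξ + a * ξ * y with hw
  have hw0 : a - ξ < w := by linarith [mul_pos (mul_pos ha hξ) hy]
  have hwpos : 0 < w := by linarith
  have hμpos : 0 < μ x := by rw [hμ, ← hydef]; linarith
  have hμ1 : μ x < 1 := by rw [hμ, ← hydef]; linarith [mul_pos ha hy]
  have hu : 1 - μ x * (1 + ξ * y) = y * w := by rw [hμ, ← hydef, hw]; ring
  refine ⟨⟨?_, ?_⟩, ?_⟩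
  · rw [hth, one_div, lt_inv_mul_iff₀ hμpos]
    have h1 : 8 / 27 * x ^ 3 < y * w := by
      rw [hxpow]; linarith [mul_lt_mul_of_pos_left (hx3.trans hw0) hy]
    have h2 : (μ x) ^ 3 * x ^ 3 ≤ x ^ 3 :=
      mul_le_of_le_one_left (by positivity) (pow_le_one₀ hμpos.le hμ1.le)
    linarith
  · rw [hth, hts]
    have : 0 < 8 / 27 * μ x ^ 3 * x ^ 3 := by positivity
    exact mul_lt_of_lt_one_right (by positivity) (by linarith)
  · have hyw : 0 < y * w := mul_pos hy hwpos
    have hder : HasDerivAt (fun x' => r (1 + ξ * y) x')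
        ((y * w) ^ ((2 : ℝ) / 3) +
          x * (a * (n * x ^ (n - 1)) * (1 + ξ * y) * (2 / 3) * (y * w) ^ ((2 : ℝ) / 3 - 1))) x := by
      have hin : HasDerivAt (fun x' => 1 - (1 - a * x' ^ n) * (1 + ξ * y))
          (a * (n * x ^ (n - 1)) * (1 + ξ * y)) x := by
        exact ((((hasDerivAt_pow n x).const_mul a).const_sub 1).mul_const
          (1 + ξ * y)).const_sub 1 |>.congr_deriv (by ring)
      have hval : 1 - (1 - a * x ^ n) * (1 + ξ * y) = y * w := by rw [← hu, hμ]
      have h := (hasDerivAt_id x).mul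
        (hin.rpow_const (p := (2 : ℝ) / 3) (Or.inl (by rw [hval]; exact hyw.ne')))
      simp only [hval, id, one_mul] at h
      refine h.congr_of_eventuallyEq (Filter.Eventually.of_forall fun x' => ?_)
      simp [hr, hμ]
    have hpw : (y * w) ^ ((2 : ℝ) / 3) = (y * w) * (y * w) ^ (-(1 / 3) : ℝ) := by
      rw [← Real.rpow_one_add' hyw.le (by norm_num)]; norm_num
    have hyx : x * x ^ (n - 1) = y := by rw [← pow_succ', Nat.sub_add_cancel hn1]
    have hyrpow : y * y ^ (-(1 / 3) : ℝ) = x ^ (n - 1) * x ^ ((3 - n : ℝ) / 3) := by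
      rw [hydef, ← Real.rpow_natCast x n, ← Real.rpow_natCast x (n - 1), ← Real.rpow_mul hx.le,
        ← Real.rpow_add hx, ← Real.rpow_add hx, Nat.cast_sub hn1]
      congr 1
      push_cast
      ring
    rw [hder.deriv, hpw, show (2 : ℝ) / 3 - 1 = -(1 / 3) by norm_num,
      Real.mul_rpow hy.le hwpos.le]
    have hle := mul_le_mul_of_nonneg_left hF.le (pow_pos hx (n - 1)).le
    refine ge_iff_le.2 (le_trans (le_of_eq ?_) (hle.trans_eq (by ring)))
    linear_combination (w ^ (-(1 / 3) : ℝ) * (w + 2 / 3 * a * n * (1 + ξ * y))) * hyrpow +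
      a * n * (1 + ξ * y) * (2 / 3) * (y ^ (-(1 / 3) : ℝ) * w ^ (-(1 / 3) : ℝ)) * hyx
end

section
/- Fix an integer n ≥ 1 and a > 0, set μ(x) = 1 − a xⁿ and t₀(x) = (1/μ(x))(1 − (2/3)^{3/2} μ(x)³ x³). Then there exist ξ > 0 and δ > 0 such that 1 + ξ xⁿ < t₀(x) for all x ∈ (0, δ) if and only if n ∈ {1, 2}, or n = 3 and a > (2/3)^{3/2}. -/
open Filter Topology in
/-- If `c (1 - a xᵏ⁺³)³ < (a - ξ) xᵏ + a ξ x²ᵏ⁺³` for small `x > 0`, then the inequality of the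
values at `x = 0` holds non-strictly. -/
theorem le_of_forall_small_lt {a c ξ δ : ℝ} {k : ℕ} (hδ : 0 < δ)
    (h : ∀ x : ℝ, 0 < x → x < δ →
      c * (1 - a * x ^ (k + 3)) ^ 3 < (a - ξ) * x ^ k + a * ξ * x ^ (2 * k + 3)) :
    c ≤ (a - ξ) * 0 ^ k := by
  have hl : Tendsto (fun x : ℝ => c * (1 - a * x ^ (k + 3)) ^ 3) (𝓝[>] 0)
      (𝓝 (c * (1 - a * 0 ^ (k + 3)) ^ 3)) :=
    (Continuous.tendsto (by fun_prop) 0).mono_left nhdsWithin_le_nhds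
  have hr : Tendsto (fun x : ℝ => (a - ξ) * x ^ k + a * ξ * x ^ (2 * k + 3)) (𝓝[>] 0)
      (𝓝 ((a - ξ) * 0 ^ k + a * ξ * 0 ^ (2 * k + 3))) :=
    (Continuous.tendsto (by fun_prop) 0).mono_left nhdsWithin_le_nhds
  have hle := le_of_tendsto_of_tendsto hl hr (by
    filter_upwards [Ioo_mem_nhdsGT hδ] with x hx using (h x hx.1 hx.2).le)
  simpa using hle

/-- Clearing the positive denominator `1 - a xⁿ` in `1 + ξ xⁿ < t₀(x)`. -/
theorem one_add_lt_iff_of_pos {a c ξ x : ℝ} {n : ℕ} (hμ : 0 < 1 - a * x ^ n) :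
    1 + ξ * x ^ n < (1 / (1 - a * x ^ n)) * (1 - c * (1 - a * x ^ n) ^ 3 * x ^ 3) ↔
      c * (1 - a * x ^ n) ^ 3 * x ^ 3 < (a - ξ) * x ^ n + a * ξ * (x ^ n) ^ 2 := by
  rw [one_div_mul_eq_div, lt_div_iff₀ hμ]
  constructor <;> intro h <;> linarith

/-- The factor `1 - a xⁿ` is positive for `0 < x < min 1 (1 / a)`. -/
theorem one_sub_mul_pow_pos {a x : ℝ} {n : ℕ} (hn : 1 ≤ n) (ha : 0 < a) (hx : 0 < x)
    (hx1 : x < 1) (hxa : x < 1 / a) : 0 < 1 - a * x ^ n := by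
  have h1 : x ^ n ≤ x := pow_le_of_le_one hx.le hx1.le (by omega)
  have h2 : x * a < 1 := (lt_div_iff₀ ha).1 hxa
  nlinarith

/-- A bound `c x³ ≤ (a - ξ) xⁿ` near `0` places `1 + ξ xⁿ` below `t₀`. -/
theorem exists_lt_of_mul_cube_le {a c ξ ε : ℝ} {n : ℕ} (hn : 1 ≤ n) (ha : 0 < a) (hc : 0 < c)
    (hξ : 0 < ξ) (hε : 0 < ε)
    (h : ∀ x : ℝ, 0 < x → x < 1 → x < ε → c * x ^ 3 ≤ (a - ξ) * x ^ n) :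
    ∃ ξ > (0 : ℝ), ∃ δ > (0 : ℝ), ∀ x : ℝ, 0 < x → x < δ →
      1 + ξ * x ^ n < (1 / (1 - a * x ^ n)) * (1 - c * (1 - a * x ^ n) ^ 3 * x ^ 3) := by
  refine ⟨ξ, hξ, min (min 1 (1 / a)) ε, by positivity, fun x hx hxδ => ?_⟩
  obtain ⟨⟨hx1, hxa⟩, hxε⟩ : (x < 1 ∧ x < 1 / a) ∧ x < ε := by simpa only [lt_min_iff] using hxδ
  have hμ := one_sub_mul_pow_pos hn ha hx hx1 hxa
  rw [one_add_lt_iff_of_pos hμ]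
  have hμ1 : (1 - a * x ^ n) ^ 3 ≤ 1 :=
    pow_le_one₀ hμ.le (sub_le_self _ (by positivity))
  have h1 : c * x ^ 3 * (1 - a * x ^ n) ^ 3 ≤ c * x ^ 3 :=
    mul_le_of_le_one_right (by positivity) hμ1
  have h2 : 0 < a * ξ * (x ^ n) ^ 2 := by positivity
  linarith [h x hx hx1 hxε]

/-- The supersolution `t_ξ(x) = 1 + ξ xⁿ` can be placed below the photon
surface starting time `t₀(x)` near `x = 0` if and only if `n ∈ {1,2}`, or
`n = 3` and `a > (2/3)^{3/2}`. -/
theorem stmt_8 (n : ℕ) (hn : 1 ≤ n) (a : ℝ) (ha : 0 < a)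
    (μ t₀ : ℝ → ℝ)
    (hμ : ∀ x, μ x = 1 - a * x ^ n)
    (ht₀ : ∀ x, t₀ x =
      (1 / μ x) * (1 - (2 / 3 : ℝ) ^ ((3 : ℝ) / 2) * (μ x) ^ 3 * x ^ 3)) :
    (∃ ξ > (0 : ℝ), ∃ δ > (0 : ℝ), ∀ x : ℝ, 0 < x → x < δ → 1 + ξ * x ^ n < t₀ x)
      ↔ (n = 1 ∨ n = 2 ∨ (n = 3 ∧ a > (2 / 3 : ℝ) ^ ((3 : ℝ) / 2))) := by
  simp only [ht₀, hμ]
  have hc : (0 : ℝ) < (2 / 3 : ℝ) ^ ((3 : ℝ) / 2) := by positivity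
  generalize (2 / 3 : ℝ) ^ ((3 : ℝ) / 2) = c at hc ⊢
  constructor
  · rintro ⟨ξ, hξ, δ, hδ, h⟩
    rcases (by omega : n = 1 ∨ n = 2 ∨ 3 ≤ n) with h1 | h2 | h3
    · exact Or.inl h1
    · exact Or.inr (Or.inl h2)
    obtain ⟨k, rfl⟩ := Nat.exists_eq_add_of_le' h3
    have hle : c ≤ (a - ξ) * 0 ^ k := by
      refine le_of_forall_small_lt (δ := min δ (min 1 (1 / a))) (by positivity) fun x hx hxδ => ?_
      obtain ⟨hxδ, hx1, hxa⟩ : x < δ ∧ x < 1 ∧ x < 1 / a := by simpa only [lt_min_iff] using hxδ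
      have hlt := (one_add_lt_iff_of_pos (one_sub_mul_pow_pos hn ha hx hx1 hxa)).1 (h x hx hxδ)
      refine lt_of_mul_lt_mul_right (hlt.trans_eq ?_) (pow_pos hx 3).le
      ring
    rcases Nat.eq_zero_or_pos k with rfl | hk
    · refine Or.inr (Or.inr ⟨rfl, ?_⟩)
      rw [pow_zero, mul_one] at hle
      linarith
    · rw [zero_pow hk.ne', mul_zero] at hle
      exact absurd hc hle.not_gt
  · rintro (rfl | rfl | ⟨rfl, hac⟩)
    · refine exists_lt_of_mul_cube_le hn ha hc (half_pos ha) (ε := a / 2 / c) (by positivity)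
        fun x hx hx1 hxε => ?_
      have h1 : x * c < a / 2 := (lt_div_iff₀ hc).1 hxε
      have h2 : x ^ 3 ≤ x ^ 2 := pow_le_pow_of_le_one hx.le hx1.le (by norm_num)
      nlinarith
    · refine exists_lt_of_mul_cube_le hn ha hc (half_pos ha) (ε := a / 2 / c) (by positivity)
        fun x hx _ hxε => ?_
      have h1 : x * c < a / 2 := (lt_div_iff₀ hc).1 hxε
      nlinarith [pow_pos hx 2]
    · refine exists_lt_of_mul_cube_le hn ha hc (sub_pos.2 hac) one_pos fun x _ _ _ => ?_
      rw [sub_sub_cancel]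
end

section
/- Let μ : (0,∞) → (0,∞) be C¹ with 3μ(x) + 2xμ′(x) ≥ 0 for all x > 0, and define r(t,x) = x(1 − μ(x) t)^{2/3} for t < t_s(x) := 1/μ(x) and t_h(x) = (1/μ(x))(1 − (8/27) μ(x)³ x³). Let 0 < x₁ < x_b and let t : (x₁, x_b] → ℝ be differentiable with t(x) < t_s(x) and t′(x) = r_x(t(x), x) for all x ∈ (x₁, x_b], and suppose t(x_b) < t_h(x_b). Then t(x) < t_h(x) for all x ∈ (x₁, x_b]. -/
open Set in
/-- Backward comparison for the linear differential inequality `w' ≤ -K w`. -/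
theorem pos_left_of_deriv_le_neg_mul {a b : ℝ} (hab : a ≤ b) {w K : ℝ → ℝ}
    (hw : ContinuousOn w (Icc a b)) (hK : ContinuousOn K (Icc a b))
    (hd : ∀ x ∈ Ioo a b, ∃ w', HasDerivAt w w' x ∧ w' ≤ -K x * w x) (hb : 0 < w b) :
    0 < w a := by
  set k : ℝ → ℝ := IccExtend hab ((Icc a b).domRestrict K) with hk
  have hkc : Continuous k := hK.domRestrict.Icc_extend'
  have hkx : ∀ x ∈ Icc a b, k x = K x := fun x hx => IccExtend_of_mem hab _ hx
  have hE : ∀ x, HasDerivAt (fun y => ∫ u in a..y, k u) (k x) x := fun x =>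
    hkc.integral_hasStrictDerivAt a x |>.hasDerivAt
  set E : ℝ → ℝ := fun y => ∫ u in a..y, k u
  have hEc : Continuous E := continuous_iff_continuousAt.2 fun x => (hE x).continuousAt
  have hanti : AntitoneOn (fun x => w x * Real.exp (E x)) (Icc a b) := by
    have key : ∀ x ∈ interior (Icc a b), ∃ c ≤ 0,
        HasDerivAt (fun x => w x * Real.exp (E x)) c x := by
      intro x hx
      rw [interior_Icc] at hx
      obtain ⟨w', hw', hle⟩ := hd x hx
      refine ⟨_, ?_, hw'.mul (hE x).exp⟩
      rw [hkx x (Ioo_subset_Icc_self hx)]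
      nlinarith [Real.exp_pos (E x)]
    refine antitoneOn_of_deriv_nonpos (convex_Icc a b)
      (hw.mul (Real.continuous_exp.comp hEc).continuousOn) ?_ ?_
    · intro x hx
      obtain ⟨c, -, h⟩ := key x hx
      exact h.differentiableAt.differentiableWithinAt
    · intro x hx
      obtain ⟨c, hc, h⟩ := key x hx
      exact h.deriv.trans_le hc
  have h := hanti (left_mem_Icc.2 hab) (right_mem_Icc.2 hab) hab
  have hpos : 0 < w a * Real.exp (E a) := (mul_pos hb (Real.exp_pos _)).trans_le h
  exact pos_of_mul_pos_left hpos (Real.exp_pos _).le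

/-- Being below the apparent horizon, in terms of the cube root of `1 - m t`. -/
theorem lt_horizon_iff {m x t : ℝ} (hm : 0 < m) (hx : 0 < x) (ht : 0 < 1 - m * t) :
    t < 1 / m * (1 - 8 / 27 * m ^ 3 * x ^ 3) ↔
      0 < (1 - m * t) ^ ((1 : ℝ) / 3) - 2 / 3 * x * m := by
  have hs3 : ((1 - m * t) ^ ((1 : ℝ) / 3)) ^ 3 = 1 - m * t := by
    rw [← Real.rpow_natCast, ← Real.rpow_mul ht.le]; norm_num
  have hs : 0 ≤ (1 - m * t) ^ ((1 : ℝ) / 3) := by positivity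
  rw [sub_pos, ← pow_lt_pow_iff_left₀ (by positivity) hs (three_ne_zero), hs3,
    one_div_mul_eq_div, lt_div_iff₀ hm]
  constructor <;> intro h <;> nlinarith

/-- The partial derivative in `x` of the area radius `x (1 - μ(x) c)^{2/3}`. -/
theorem hasDerivAt_areaRadius {μ : ℝ → ℝ} {x c m' : ℝ} (hμ : HasDerivAt μ m' x)
    (hp : 0 < 1 - μ x * c) :
    HasDerivAt (fun y => y * (1 - μ y * c) ^ ((2 : ℝ) / 3))
      (((1 - μ x * c) ^ ((1 : ℝ) / 3)) ^ 2 -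
        2 / 3 * x * m' * c / (1 - μ x * c) ^ ((1 : ℝ) / 3)) x := by
  have h := (hasDerivAt_id x).mul (((hμ.mul_const c).const_sub 1).rpow_const
    (p := (2 : ℝ) / 3) (Or.inl hp.ne'))
  refine h.congr_deriv ?_
  have h1 : (1 - μ x * c) ^ ((2 : ℝ) / 3) = ((1 - μ x * c) ^ ((1 : ℝ) / 3)) ^ 2 := by
    rw [← Real.rpow_natCast, ← Real.rpow_mul hp.le]; norm_num
  have h2 : (1 - μ x * c) ^ ((2 : ℝ) / 3 - 1) = ((1 - μ x * c) ^ ((1 : ℝ) / 3))⁻¹ := by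
    rw [← Real.rpow_neg hp.le]; norm_num
  simp only [h1, h2, id]
  ring

/-- The cube root of `1 - μ(x) t(x)`, shifted by its horizon value `2 x μ(x) / 3`, satisfies
a linear differential equation along an outgoing radial null geodesic `t`. -/
theorem hasDerivAt_cubeRoot_sub_horizon {μ t : ℝ → ℝ} {x m' : ℝ} (hμ : HasDerivAt μ m' x)
    (hp : 0 < 1 - μ x * t x)
    (ht : HasDerivAt t (((1 - μ x * t x) ^ ((1 : ℝ) / 3)) ^ 2 -
        2 / 3 * x * m' * t x / (1 - μ x * t x) ^ ((1 : ℝ) / 3)) x) :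
    HasDerivAt (fun y => (1 - μ y * t y) ^ ((1 : ℝ) / 3) - 2 / 3 * y * μ y)
      (-(m' * t x / (3 * (1 - μ x * t x))) *
        ((1 - μ x * t x) ^ ((1 : ℝ) / 3) - 2 / 3 * x * μ x) -
        1 / 3 * (3 * μ x + 2 * x * m')) x := by
  have h := (((hμ.mul ht).const_sub 1).rpow_const (p := (1 : ℝ) / 3) (Or.inl hp.ne')).sub
    (((hasDerivAt_id x).const_mul (2 / 3)).mul hμ)
  refine h.congr_deriv ?_
  have hs : 0 < (1 - μ x * t x) ^ ((1 : ℝ) / 3) := by positivity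
  have hs3 : 1 - μ x * t x = ((1 - μ x * t x) ^ ((1 : ℝ) / 3)) ^ 3 := by
    rw [← Real.rpow_natCast, ← Real.rpow_mul hp.le]; norm_num
  have h2 : (1 - μ x * t x) ^ ((1 : ℝ) / 3 - 1) =
      (((1 - μ x * t x) ^ ((1 : ℝ) / 3)) ^ 2)⁻¹ := by
    rw [← Real.rpow_natCast, ← Real.rpow_mul hp.le, ← Real.rpow_neg hp.le]; norm_num
  simp only [Pi.mul_apply, h2, id]
  have h3 : m' * t x / (3 * (1 - μ x * t x)) =
      m' * t x / (3 * ((1 - μ x * t x) ^ ((1 : ℝ) / 3)) ^ 3) := by rw [← hs3]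
  rw [h3]
  set s := (1 - μ x * t x) ^ ((1 : ℝ) / 3)
  field_simp
  ring


/-- Comparison with the apparent horizon: an outgoing radial null geodesic
`t(x)` (solving `t' = r_x(t,x)`) which starts below the apparent horizon curve
`t_h` at the star boundary stays strictly below it. -/
theorem stmt_14 (μ : ℝ → ℝ) (hμpos : ∀ x > 0, 0 < μ x)
    (hμC1 : ContDiffOn ℝ 1 μ (Set.Ioi 0))
    (hmass : ∀ x > 0, 0 ≤ 3 * μ x + 2 * x * deriv μ x)
    (r : ℝ → ℝ → ℝ)
    (hr : ∀ t x, r t x = x * (1 - μ x * t) ^ ((2 : ℝ) / 3))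
    (ts th : ℝ → ℝ)
    (hts : ∀ x, ts x = 1 / μ x)
    (hth : ∀ x, th x = (1 / μ x) * (1 - 8 / 27 * (μ x) ^ 3 * x ^ 3))
    (x₁ xb : ℝ) (hx₁ : 0 < x₁) (hx₁b : x₁ < xb)
    (t : ℝ → ℝ)
    (hode : ∀ x : ℝ, x₁ < x → x ≤ xb →
      t x < ts x ∧
      HasDerivWithinAt t (deriv (fun x' => r (t x) x') x) (Set.Ioc x₁ xb) x)
    (hinit : t xb < th xb) :
    ∀ x : ℝ, x₁ < x → x ≤ xb → t x < th x := by
  intro x₀ hx₀ hx₀b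
  have hp : ∀ x, x₁ < x → x ≤ xb → 0 < 1 - μ x * t x := by
    intro x h1 h2
    have h := (hode x h1 h2).1
    rw [hts, lt_div_iff₀ (hμpos x (hx₁.trans h1))] at h
    linarith
  have hμd : ∀ x > 0, HasDerivAt μ (deriv μ x) x := fun x hx =>
    ((hμC1.differentiableOn one_ne_zero).differentiableAt (Ioi_mem_nhds hx)).hasDerivAt
  have hsub : Set.Icc x₀ xb ⊆ Set.Ioi 0 := fun x hx => hx₁.trans (hx₀.trans_le hx.1)
  have hμc : ContinuousOn μ (Set.Icc x₀ xb) := hμC1.continuousOn.mono hsub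
  have hμ'c : ContinuousOn (deriv μ) (Set.Icc x₀ xb) :=
    (hμC1.continuousOn_deriv_of_isOpen isOpen_Ioi le_rfl).mono hsub
  have htc : ContinuousOn t (Set.Icc x₀ xb) := fun x hx =>
    (hode x (hx₀.trans_le hx.1) hx.2).2.continuousWithinAt.mono
      fun y hy => ⟨hx₀.trans_le hy.1, hy.2⟩
  have hpc : ContinuousOn (fun x => 1 - μ x * t x) (Set.Icc x₀ xb) :=
    continuousOn_const.sub (hμc.mul htc)
  have hp' : ∀ x ∈ Set.Icc x₀ xb, 0 < 1 - μ x * t x := fun x hx =>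
    hp x (hx₀.trans_le hx.1) hx.2
  rw [hth, lt_horizon_iff (hμpos _ (hx₁.trans hx₀)) (hx₁.trans hx₀) (hp _ hx₀ hx₀b)]
  have hxb := hx₁.trans hx₁b
  rw [hth, lt_horizon_iff (hμpos _ hxb) hxb (hp _ hx₁b le_rfl)] at hinit
  refine pos_left_of_deriv_le_neg_mul hx₀b
    (w := fun y => (1 - μ y * t y) ^ ((1 : ℝ) / 3) - 2 / 3 * y * μ y)
    (K := fun y => deriv μ y * t y / (3 * (1 - μ y * t y))) ?_ ?_ ?_ hinit
  · exact (hpc.rpow_const fun x hx => Or.inl (hp' x hx).ne').sub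
      ((continuousOn_const.mul continuousOn_id).mul hμc)
  · exact (hμ'c.mul htc).div (continuousOn_const.mul hpc)
      fun x hx => (mul_pos three_pos (hp' x hx)).ne'
  · intro x hx
    have h1 : x₁ < x := hx₀.trans hx.1
    have hpx := hp x h1 hx.2.le
    have hμx := hμd x (hx₁.trans h1)
    have ht := (hode x h1 hx.2.le).2.hasDerivAt (Ioc_mem_nhds h1 hx.2)
    simp only [hr] at ht
    rw [(hasDerivAt_areaRadius hμx hpx).deriv] at ht
    refine ⟨_, hasDerivAt_cubeRoot_sub_horizon hμx hpx ht, ?_⟩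
    linarith [hmass x (hx₁.trans h1)]
end

section
/- Fix an integer n and a > 0 with either n ∈ {1, 2}, or n = 3 and a > 2(26 + 15√3)/27, and set μ(x) = 1 − a xⁿ. Then there exist ξ ∈ (0, a) and x̄ > 0 such that for every x_b ∈ (0, x̄] the following holds: the solution t(x) of the outgoing radial null geodesic equation t′(x) = r_x(t(x), x) with initial condition t(x_b) = t₀(x_b) extends backwards to the whole interval (0, x_b], satisfies 1 + ξ xⁿ ≤ t(x) ≤ t_h(x) for all x ∈ (0, x_b], and lim_{x→0⁺} t(x) = 1. -/
/-- Mass profile function `μ(x) = 1 - a xⁿ` of the marginally bound LTB collapse. -/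
noncomputable def muf (a : ℝ) (n : ℕ) (x : ℝ) : ℝ := 1 - a * x ^ n

/-- Singularity time `t_s(x) = 1/μ(x)`. -/
noncomputable def tsf (a : ℝ) (n : ℕ) (x : ℝ) : ℝ := 1 / muf a n x

/-- Area radius `r(t,x) = x (1 - μ(x) t)^{2/3}`. -/
noncomputable def rf (a : ℝ) (n : ℕ) (t x : ℝ) : ℝ :=
  x * (1 - muf a n x * t) ^ ((2 : ℝ) / 3)

/-- Apparent horizon curve `t_h(x) = (1/μ(x))(1 - (8/27) μ(x)³ x³)`. -/
noncomputable def thf (a : ℝ) (n : ℕ) (x : ℝ) : ℝ :=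
  (1 / muf a n x) * (1 - 8 / 27 * (muf a n x) ^ 3 * x ^ 3)

/-- Photon-sphere matching time `t₀(x) = (1/μ(x))(1 - (2/3)^{3/2} μ(x)³ x³)`,
defined by `r(t₀(x), x) = 3 m(x)`. -/
noncomputable def t0f (a : ℝ) (n : ℕ) (x : ℝ) : ℝ :=
  (1 / muf a n x) * (1 - (2 / 3 : ℝ) ^ ((3 : ℝ) / 2) * (muf a n x) ^ 3 * x ^ 3)

open Set Filter Topology in
/-- A function which is continuous at every point of the closed region between two continuous
curves over a compact interval is bounded on that region. -/
theorem exists_bound_between_curves {F : ℝ × ℝ → ℝ} {L U : ℝ → ℝ} {e b : ℝ}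
    (hL : ContinuousOn L (Icc e b)) (hU : ContinuousOn U (Icc e b))
    (hLU : ∀ x ∈ Icc e b, L x ≤ U x)
    (hF : ∀ x ∈ Icc e b, ∀ p ∈ Icc (L x) (U x), ContinuousAt F (x, p)) :
    ∃ C : ℝ, 0 ≤ C ∧ ∀ x ∈ Icc e b, ∀ p ∈ Icc (L x) (U x), |F (x, p)| ≤ C := by
  let S : Set (ℝ × ℝ) := Icc e b ×ˢ Icc (0 : ℝ) 1
  let φ : ℝ × ℝ → ℝ × ℝ := fun q => (q.1, L q.1 + q.2 * (U q.1 - L q.1))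
  have hS : IsCompact S := isCompact_Icc.prod isCompact_Icc
  have hfst : MapsTo (Prod.fst : ℝ × ℝ → ℝ) S (Icc e b) := fun q hq => hq.1
  have hL' : ContinuousOn (fun q : ℝ × ℝ => L q.1) S := hL.comp continuousOn_fst hfst
  have hU' : ContinuousOn (fun q : ℝ × ℝ => U q.1) S := hU.comp continuousOn_fst hfst
  have hφ : ContinuousOn φ S :=
    continuousOn_fst.prodMk (hL'.add (continuousOn_snd.mul (hU'.sub hL')))
  let T : Set (ℝ × ℝ) := {q | q.1 ∈ Icc e b ∧ q.2 ∈ Icc (L q.1) (U q.1)}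
  have hFT : ContinuousOn F T := fun q hq => (hF q.1 hq.1 q.2 hq.2).continuousWithinAt
  have hTS : T ⊆ φ '' S := by
    rintro ⟨x, p⟩ ⟨hx, hp⟩
    simp only at hx hp
    rcases eq_or_lt_of_le (hp.1.trans hp.2) with h | h
    · exact ⟨(x, 0), ⟨hx, by simp⟩, by
        simp only [φ, Prod.mk.injEq, true_and]; linarith [hp.1, hp.2]⟩
    · have h' : 0 < U x - L x := sub_pos.2 h
      refine ⟨(x, (p - L x) / (U x - L x)), ⟨hx, ?_, ?_⟩, ?_⟩
      · exact div_nonneg (sub_nonneg.2 hp.1) h'.le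
      · exact (div_le_one h').2 (by linarith [hp.2])
      · simp only [φ, Prod.mk.injEq, true_and]
        field_simp
        ring
  have hST : φ '' S ⊆ T := by
    rintro _ ⟨⟨x, θ⟩, ⟨hx, hθ⟩, rfl⟩
    have := hLU x hx
    simp only at hx hθ
    refine ⟨hx, ?_, ?_⟩ <;> simp only [φ]
    · nlinarith [hθ.1]
    · nlinarith [hθ.2]
  have hT : IsCompact T := by
    rw [Subset.antisymm hTS hST]
    exact hS.image_of_continuousOn hφ
  obtain ⟨C, hC⟩ := hT.exists_bound_of_continuousOn hFT
  exact ⟨max C 0, le_max_right _ _, fun x hx p hp =>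
    (hC (x, p) ⟨hx, hp⟩).trans (le_max_left _ _)⟩

open Set Filter Topology in
/-- Backward comparison: if `g ≤ h` at the right end point and `h` grows strictly slower than `g`
wherever the two meet, then `g ≤ h` on the whole interval. -/
theorem le_of_deriv_lt_of_eq_backward {g h g' h' : ℝ → ℝ} {e b : ℝ}
    (hg : ∀ x ∈ Icc e b, HasDerivWithinAt g (g' x) (Icc e b) x)
    (hh : ∀ x ∈ Icc e b, HasDerivWithinAt h (h' x) (Icc e b) x)
    (hb : g b ≤ h b) (hlt : ∀ x ∈ Icc e b, g x = h x → h' x < g' x) :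
    ∀ x ∈ Icc e b, g x ≤ h x := by
  have hmaps : MapsTo (fun y : ℝ => -y) (Icc (-b) (-e)) (Icc e b) := fun y hy =>
    ⟨by linarith [hy.2], by linarith [hy.1]⟩
  have key : ∀ {k k' : ℝ → ℝ}, (∀ x ∈ Icc e b, HasDerivWithinAt k (k' x) (Icc e b) x) →
      ∀ y ∈ Icc (-b) (-e),
        HasDerivWithinAt (fun y => k (-y)) (-k' (-y)) (Icc (-b) (-e)) y := by
    intro k k' hk y hy
    have := (hk (-y) (hmaps hy)).scomp y (hasDerivAt_neg y).hasDerivWithinAt hmaps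
    simpa [Function.comp_def] using this
  have key2 : ∀ {k : ℝ → ℝ} {d y : ℝ}, y ∈ Ico (-b) (-e) →
      HasDerivWithinAt k d (Icc (-b) (-e)) y → HasDerivWithinAt k d (Ici y) y := by
    intro k d y hy hk
    refine (hk.mono (Icc_subset_Icc_left hy.1)).mono_of_mem_nhdsWithin ?_
    exact Icc_mem_nhdsGE hy.2
  have := image_le_of_deriv_right_lt_deriv_boundary'
    (f := fun y => g (-y)) (f' := fun y => -g' (-y)) (B := fun y => h (-y))
    (B' := fun y => -h' (-y)) (a := -b) (b := -e)
    (fun y hy => (key hg y hy).continuousWithinAt)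
    (fun y hy => key2 hy (key hg y (Ico_subset_Icc_self hy))) (by simpa using hb)
    (fun y hy => (key hh y hy).continuousWithinAt)
    (fun y hy => key2 hy (key hh y (Ico_subset_Icc_self hy)))
    (fun y hy h => neg_lt_neg (hlt _ (hmaps (Ico_subset_Icc_self hy)) h))
  intro x hx
  simpa using this (x := -x) ⟨by linarith [hx.2], by linarith [hx.1]⟩

open Set in
theorem clamp_mem_Icc {l u : ℝ} (h : l ≤ u) (p : ℝ) : max l (min p u) ∈ Icc l u :=
  ⟨le_max_left _ _, max_le h (min_le_right _ _)⟩

theorem abs_clamp_sub_clamp_le (l u p q : ℝ) :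
    |max l (min p u) - max l (min q u)| ≤ |p - q| := by
  rw [max_comm l, max_comm l]
  refine (abs_max_sub_max_le_abs _ _ _).trans ?_
  refine (abs_min_sub_min_le_max _ _ _ _).trans ?_
  simp

open Set Filter Topology in
/-- Solution of a scalar ODE prescribed at the right end point of a compact interval and confined
between a lower and an upper backward barrier. -/
theorem exists_solution_between_barriers {f : ℝ → ℝ → ℝ} {L U L' U' : ℝ → ℝ} {e b t₀ : ℝ}
    (heb : e ≤ b)
    (hL : ∀ x ∈ Icc e b, HasDerivAt L (L' x) x) (hU : ∀ x ∈ Icc e b, HasDerivAt U (U' x) x)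
    (hLU : ∀ x ∈ Icc e b, L x ≤ U x)
    (hfc : ∀ x ∈ Icc e b, ∀ p ∈ Icc (L x) (U x), ContinuousAt (fun q : ℝ × ℝ => f q.1 q.2) (x, p))
    {K : NNReal} (hK : ∀ x ∈ Icc e b, LipschitzOnWith K (f x) (Icc (L x) (U x)))
    (hfL : ∀ x ∈ Icc e b, f x (L x) < L' x) (hfU : ∀ x ∈ Icc e b, U' x < f x (U x))
    (h₀ : t₀ ∈ Icc (L b) (U b)) :
    ∃ t : ℝ → ℝ, t b = t₀ ∧ ∀ x ∈ Icc e b,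
      HasDerivWithinAt t (f x (t x)) (Icc e b) x ∧ t x ∈ Icc (L x) (U x) := by
  have hLc : ContinuousOn L (Icc e b) := fun x hx => (hL x hx).continuousAt.continuousWithinAt
  have hUc : ContinuousOn U (Icc e b) := fun x hx => (hU x hx).continuousAt.continuousWithinAt
  obtain ⟨C, hC0, hC⟩ := exists_bound_between_curves hLc hUc hLU hfc
  let c : ℝ → ℝ → ℝ := fun x p => max (L x) (min p (U x))
  have hc : ∀ x ∈ Icc e b, ∀ p, c x p ∈ Icc (L x) (U x) := fun x hx p =>
    clamp_mem_Icc (hLU x hx) p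
  let v : ℝ → ℝ → ℝ := fun x p => f x (c x p)
  let R : ℝ := C * (b - e)
  have hR : 0 ≤ R := mul_nonneg hC0 (sub_nonneg.2 heb)
  have hPL : IsPicardLindelof v (tmin := e) (tmax := b) ⟨b, heb, le_rfl⟩ t₀
      ⟨R, hR⟩ 0 ⟨C, hC0⟩ K := by
    refine ⟨fun x hx => LipschitzWith.lipschitzOnWith ?_, fun p _ x hx => ?_, fun x hx p _ => ?_, ?_⟩
    · refine LipschitzWith.of_dist_le_mul fun p q => ?_
      refine ((hK x hx).dist_le_mul _ (hc x hx p) _ (hc x hx q)).trans ?_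
      gcongr
      exact abs_clamp_sub_clamp_le _ _ _ _
    · have h1 : ContinuousWithinAt (fun x => (x, c x p)) (Icc e b) x :=
        continuousWithinAt_id.prodMk
          ((hLc x hx).max (continuousWithinAt_const.min (hUc x hx)))
      exact (hfc x hx _ (hc x hx p)).comp_continuousWithinAt (f := fun x => (x, c x p)) h1
    · exact hC x hx _ (hc x hx p)
    · simp only [sub_self, max_eq_right (sub_nonneg.2 heb), NNReal.coe_zero, sub_zero]
      exact le_rfl
  obtain ⟨t, htb, ht⟩ := hPL.exists_eq_forall_mem_Icc_hasDerivWithinAt₀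
  have htb : t b = t₀ := htb
  have h1 := le_of_deriv_lt_of_eq_backward (fun x hx => (hL x hx).hasDerivWithinAt) ht
    (htb ▸ h₀.1) (fun x hx h => by
      have : c x (t x) = L x := by simp [c, ← h, hLU x hx]
      simpa [v, this] using hfL x hx)
  have h2 := le_of_deriv_lt_of_eq_backward ht (fun x hx => (hU x hx).hasDerivWithinAt)
    (htb ▸ h₀.2) (fun x hx h => by
      have : c x (t x) = U x := by simp [c, h, hLU x hx]
      simpa [v, this] using hfU x hx)
  refine ⟨t, htb, fun x hx => ⟨?_, h1 x hx, h2 x hx⟩⟩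
  have : c x (t x) = t x := by simp [c, h1 x hx, h2 x hx]
  simpa [v, this] using ht x hx

open Set Filter Topology in
/-- Solution of a scalar ODE prescribed at `b > 0` which extends back over `(0, b]` between a lower
and an upper backward barrier; the equation may be singular at `0`. -/
theorem exists_solution_between_barriers_Ioc {f f' : ℝ → ℝ → ℝ} {L U L' U' : ℝ → ℝ} {b t₀ : ℝ}
    (hL : ∀ x ∈ Ioc 0 b, HasDerivAt L (L' x) x) (hU : ∀ x ∈ Ioc 0 b, HasDerivAt U (U' x) x)
    (hLU : ∀ x ∈ Ioc 0 b, L x ≤ U x)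
    (hf : ∀ x ∈ Ioc 0 b, ∀ p ∈ Icc (L x) (U x), HasDerivAt (f x) (f' x p) p)
    (hfc : ∀ x ∈ Ioc 0 b, ∀ p ∈ Icc (L x) (U x), ContinuousAt (fun q : ℝ × ℝ => f q.1 q.2) (x, p))
    (hfc' : ∀ x ∈ Ioc 0 b, ∀ p ∈ Icc (L x) (U x),
      ContinuousAt (fun q : ℝ × ℝ => f' q.1 q.2) (x, p))
    (hfL : ∀ x ∈ Ioc 0 b, f x (L x) < L' x) (hfU : ∀ x ∈ Ioc 0 b, U' x < f x (U x))
    (hb : 0 < b) (h₀ : t₀ ∈ Icc (L b) (U b)) :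
    ∃ t : ℝ → ℝ, t b = t₀ ∧ ∀ x ∈ Ioc 0 b,
      HasDerivWithinAt t (f x (t x)) (Ioc 0 b) x ∧ t x ∈ Icc (L x) (U x) := by
  have hsub : ∀ {e : ℝ}, 0 < e → Icc e b ⊆ Ioc 0 b := fun he x hx => ⟨he.trans_le hx.1, hx.2⟩
  have hLip : ∀ e, 0 < e → ∃ K : NNReal, ∀ x ∈ Icc e b,
      LipschitzOnWith K (f x) (Icc (L x) (U x)) := by
    intro e he
    obtain ⟨C, hC0, hC⟩ := exists_bound_between_curves
      (F := fun q : ℝ × ℝ => f' q.1 q.2) (e := e) (b := b)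
      (fun x hx => (hL x (hsub he hx)).continuousAt.continuousWithinAt)
      (fun x hx => (hU x (hsub he hx)).continuousAt.continuousWithinAt)
      (fun x hx => hLU x (hsub he hx)) (fun x hx => hfc' x (hsub he hx))
    refine ⟨⟨C, hC0⟩, fun x hx => ?_⟩
    exact (convex_Icc _ _).lipschitzOnWith_of_nnnorm_hasDerivWithin_le
      (fun p hp => (hf x (hsub he hx) p hp).hasDerivWithinAt) (fun p hp => hC x hx p hp)
  have hsol : ∀ e : ℝ, ∃ t : ℝ → ℝ, 0 < e → e ≤ b → t b = t₀ ∧ ∀ x ∈ Icc e b,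
      HasDerivWithinAt t (f x (t x)) (Icc e b) x ∧ t x ∈ Icc (L x) (U x) := by
    intro e
    by_cases he : 0 < e ∧ e ≤ b
    · obtain ⟨K, hK⟩ := hLip e he.1
      obtain ⟨t, ht⟩ := exists_solution_between_barriers he.2 (fun x hx => hL x (hsub he.1 hx))
        (fun x hx => hU x (hsub he.1 hx)) (fun x hx => hLU x (hsub he.1 hx))
        (fun x hx => hfc x (hsub he.1 hx)) hK
        (fun x hx => hfL x (hsub he.1 hx)) (fun x hx => hfU x (hsub he.1 hx)) h₀
      exact ⟨t, fun _ _ => ht⟩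
    · exact ⟨0, fun h1 h2 => (he ⟨h1, h2⟩).elim⟩
  choose T hT using hsol
  have hagree : ∀ e₁ e₂, 0 < e₁ → e₁ ≤ e₂ → e₂ ≤ b → EqOn (T e₁) (T e₂) (Icc e₂ b) := by
    intro e₁ e₂ h1 h12 h2
    obtain ⟨K, hK⟩ := hLip e₂ (h1.trans_le h12)
    have hT2 := hT e₂ (h1.trans_le h12) h2
    have hT1 := hT e₁ h1 (h12.trans h2)
    have hm : Icc e₂ b ⊆ Icc e₁ b := Icc_subset_Icc_left h12
    have hI : ∀ {k : ℝ → ℝ} {d x : ℝ}, x ∈ Ioc e₂ b →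
        HasDerivWithinAt k d (Icc e₂ b) x → HasDerivWithinAt k d (Iic x) x := by
      intro k d x hx hk
      exact (hk.mono (Icc_subset_Icc_right hx.2)).mono_of_mem_nhdsWithin (Icc_mem_nhdsLE hx.1)
    exact ODE_solution_unique_of_mem_Icc_left (s := fun x => Icc (L x) (U x))
      (fun x hx => hK x (Ioc_subset_Icc_self hx))
      (fun x hx => ((hT1.2 x (hm hx)).1.mono hm).continuousWithinAt)
      (fun x hx => hI hx ((hT1.2 x (hm (Ioc_subset_Icc_self hx))).1.mono hm))
      (fun x hx => (hT1.2 x (hm (Ioc_subset_Icc_self hx))).2)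
      (fun x hx => (hT2.2 x hx).1.continuousWithinAt)
      (fun x hx => hI hx (hT2.2 x (Ioc_subset_Icc_self hx)).1)
      (fun x hx => (hT2.2 x (Ioc_subset_Icc_self hx)).2)
      (hT1.1.trans hT2.1.symm)
  refine ⟨fun x => T (x / 2) x, (hT (b / 2) (by linarith) (by linarith)).1, fun x hx => ?_⟩
  have hx0 : 0 < x := hx.1
  have hxb : x ≤ b := hx.2
  have hloc : ∀ y, x / 2 ≤ y → y ≤ b → T (y / 2) y = T (x / 4) y := fun y h1 h2 =>
    (hagree (x / 4) (y / 2) (by linarith) (by linarith) (by linarith) ⟨by linarith, h2⟩).symm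
  have hTx := (hT (x / 4) (by linarith) (by linarith)).2 x ⟨by linarith, hxb⟩
  have hxeq := hloc x (by linarith) hxb
  refine ⟨?_, by beta_reduce; rw [hxeq]; exact hTx.2⟩
  have hmem : Icc (x / 2) b ∈ 𝓝[Ioc 0 b] x := by
    filter_upwards [self_mem_nhdsWithin,
      mem_nhdsWithin_of_mem_nhds (Ioi_mem_nhds (show x / 2 < x by linarith))] with y h1 h2
    exact ⟨le_of_lt h2, h1.2⟩
  have h3 : HasDerivWithinAt (T (x / 4)) (f x (T (x / 4) x)) (Icc (x / 2) b) x :=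
    hTx.1.mono (Icc_subset_Icc_left (by linarith))
  beta_reduce
  rw [hxeq]
  exact (h3.congr (fun y hy => hloc y hy.1 hy.2) hxeq).mono_of_mem_nhdsWithin hmem

/-- The right-hand side `r_x(p, x)` of the outgoing radial null geodesic equation. -/
noncomputable def nullField (a : ℝ) (n : ℕ) (x p : ℝ) : ℝ :=
  (1 - muf a n x * p) ^ ((2 : ℝ) / 3) +
    2 / 3 * a * n * (x * x ^ (n - 1)) * p * (1 - muf a n x * p) ^ (-(1 : ℝ) / 3)

/-- The derivative of `nullField a n x p` with respect to the time `p`. -/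
noncomputable def nullFieldDeriv (a : ℝ) (n : ℕ) (x p : ℝ) : ℝ :=
  -(2 / 3 * muf a n x * (1 - muf a n x * p) ^ (-(1 : ℝ) / 3)) +
    2 / 3 * a * n * (x * x ^ (n - 1)) * ((1 - muf a n x * p) ^ (-(1 : ℝ) / 3) +
      p * (1 / 3 * muf a n x * (1 - muf a n x * p) ^ (-(4 : ℝ) / 3)))

theorem hasDerivAt_muf (a : ℝ) (n : ℕ) (x : ℝ) :
    HasDerivAt (muf a n) (-(a * (n * x ^ (n - 1)))) x := by
  exact ((hasDerivAt_pow n x).const_mul a).const_sub 1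

theorem continuous_muf (a : ℝ) (n : ℕ) : Continuous (muf a n) := by
  unfold muf
  fun_prop

theorem deriv_rf {a : ℝ} {n : ℕ} {x p : ℝ} (hs : 0 < 1 - muf a n x * p) :
    deriv (fun x' => rf a n p x') x = nullField a n x p := by
  have h1 : HasDerivAt (fun x' => 1 - muf a n x' * p) (a * (n * x ^ (n - 1)) * p) x := by
    simpa using ((hasDerivAt_muf a n x).mul_const p).const_sub 1
  have h2 := (hasDerivAt_id x).mul (h1.rpow_const (p := (2 : ℝ) / 3) (Or.inl hs.ne'))
  have h3 : ((2 : ℝ) / 3 - 1) = -1 / 3 := by norm_num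
  rw [h3] at h2
  refine (HasDerivAt.deriv (f := fun x' => rf a n p x') h2).trans ?_
  simp only [nullField, id]
  ring

theorem hasDerivAt_nullField {a : ℝ} {n : ℕ} {x p : ℝ} (hs : 0 < 1 - muf a n x * p) :
    HasDerivAt (nullField a n x) (nullFieldDeriv a n x p) p := by
  have h1 : HasDerivAt (fun p => 1 - muf a n x * p) (-muf a n x) p := by
    simpa using ((hasDerivAt_id p).const_mul (muf a n x)).const_sub 1
  have h2 := h1.rpow_const (p := (2 : ℝ) / 3) (Or.inl hs.ne')
  have h3 := h1.rpow_const (p := -(1 : ℝ) / 3) (Or.inl hs.ne')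
  have e2 : ((2 : ℝ) / 3 - 1) = -1 / 3 := by norm_num
  have e3 : (-(1 : ℝ) / 3 - 1) = -4 / 3 := by norm_num
  rw [e2] at h2
  rw [e3] at h3
  refine (h2.add (((hasDerivAt_id p).const_mul
    (2 / 3 * a * n * (x * x ^ (n - 1)))).mul h3)).congr_deriv ?_
  simp only [nullFieldDeriv, id]
  ring

theorem continuousAt_nullField {a : ℝ} {n : ℕ} {x p : ℝ} (hs : 0 < 1 - muf a n x * p) :
    ContinuousAt (fun q : ℝ × ℝ => nullField a n q.1 q.2) (x, p) := by
  have hμ := continuous_muf a n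
  have h : ∀ c : ℝ,
      ContinuousAt (fun q : ℝ × ℝ => (1 - muf a n q.1 * q.2) ^ c) (x, p) := fun c =>
    ContinuousAt.rpow_const (by fun_prop) (Or.inl hs.ne')
  have h1 := h (2 / 3)
  have h2 := h (-1 / 3)
  unfold nullField
  fun_prop

theorem continuousAt_nullFieldDeriv {a : ℝ} {n : ℕ} {x p : ℝ} (hs : 0 < 1 - muf a n x * p) :
    ContinuousAt (fun q : ℝ × ℝ => nullFieldDeriv a n q.1 q.2) (x, p) := by
  have hμ := continuous_muf a n
  have h : ∀ c : ℝ,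
      ContinuousAt (fun q : ℝ × ℝ => (1 - muf a n q.1 * q.2) ^ c) (x, p) := fun c =>
    ContinuousAt.rpow_const (by fun_prop) (Or.inl hs.ne')
  have h1 := h (-4 / 3)
  have h2 := h (-1 / 3)
  unfold nullFieldDeriv
  fun_prop

theorem one_sub_muf_mul_pos {a : ℝ} {n : ℕ} {x p : ℝ} (hx : 0 < x) (hμ : 0 < muf a n x)
    (hp : p ≤ thf a n x) : 0 < 1 - muf a n x * p := by
  have h1 : muf a n x * p ≤ muf a n x * thf a n x := by gcongr
  have h2 : muf a n x * thf a n x = 1 - 8 / 27 * muf a n x ^ 3 * x ^ 3 := by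
    unfold thf
    field_simp
  have h3 : 0 < 8 / 27 * muf a n x ^ 3 * x ^ 3 := by positivity
  linarith

theorem cube_rpow_two_thirds {y : ℝ} (hy : 0 ≤ y) : (y ^ 3) ^ ((2 : ℝ) / 3) = y ^ 2 := by
  rw [← Real.rpow_natCast y 3, ← Real.rpow_mul hy, ← Real.rpow_natCast y 2]
  norm_num

theorem cube_rpow_neg_third {y : ℝ} (hy : 0 ≤ y) : (y ^ 3) ^ (-(1 : ℝ) / 3) = y⁻¹ := by
  rw [← Real.rpow_natCast y 3, ← Real.rpow_mul hy, ← Real.rpow_neg_one y]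
  norm_num

/-- The slope of the apparent horizon curve. -/
noncomputable def thfDeriv (a : ℝ) (n : ℕ) (x : ℝ) : ℝ :=
  a * n * x ^ (n - 1) / muf a n x ^ 2 - 8 / 9 * muf a n x ^ 2 * x ^ 2 +
    16 / 27 * muf a n x * x ^ 3 * (a * n * x ^ (n - 1))

theorem hasDerivAt_thf {a : ℝ} {n : ℕ} {x : ℝ} (hμ : 0 < muf a n x) :
    HasDerivAt (thf a n) (thfDeriv a n x) x := by
  have h := hasDerivAt_muf a n x
  have h1 := ((hasDerivAt_const x (1 : ℝ)).div h hμ.ne').mul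
    ((((h.pow 3).const_mul (8 / 27)).mul (hasDerivAt_pow 3 x)).const_sub 1)
  refine HasDerivAt.congr_deriv (f := thf a n) h1 ?_
  simp only [thfDeriv, Pi.pow_apply, Pi.div_apply, Pi.mul_apply]
  field_simp
  push_cast
  ring

theorem thfDeriv_lt_nullField {a : ℝ} {n : ℕ} {x : ℝ} (hx : 0 < x) (hμ : 0 < muf a n x)
    (hsmall : 2 * a * n * (x * x ^ (n - 1)) < 3 * muf a n x) :
    thfDeriv a n x < nullField a n x (thf a n x) := by
  have hs : 1 - muf a n x * thf a n x = (2 / 3 * muf a n x * x) ^ 3 := by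
    unfold thf
    field_simp
    ring
  have hdiff : nullField a n x (thf a n x) - thfDeriv a n x =
      4 / 9 * muf a n x * x ^ 2 * (3 * muf a n x - 2 * a * n * (x * x ^ (n - 1))) := by
    unfold nullField
    rw [hs, cube_rpow_two_thirds (by positivity), cube_rpow_neg_third (by positivity)]
    unfold thfDeriv thf
    field_simp
    ring
  have : 0 < 4 / 9 * muf a n x * x ^ 2 * (3 * muf a n x - 2 * a * n * (x * x ^ (n - 1))) :=
    mul_pos (by positivity) (by linarith)
  linarith

/-- The value of `nullField` along the curve `1 + ξ xⁿ`, divided by `xⁿ⁻¹`. -/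
noncomputable def scaledSlope (a ξ : ℝ) (n : ℕ) (x : ℝ) : ℝ :=
  x ^ (1 - (n : ℝ) / 3) * ((a - ξ + a * ξ * x ^ n) ^ ((2 : ℝ) / 3) +
    2 / 3 * a * n * (1 + ξ * x ^ n) * (a - ξ + a * ξ * x ^ n) ^ (-(1 : ℝ) / 3))

theorem nullField_lower {a ξ : ℝ} {n : ℕ} {x : ℝ} (hn : n ≠ 0) (hx : 0 < x) (hξ : 0 < ξ)
    (hξa : ξ < a) : nullField a n x (1 + ξ * x ^ n) = x ^ (n - 1) * scaledSlope a ξ n x := by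
  have ha : 0 < a := hξ.trans hξa
  have hw : 0 < a - ξ + a * ξ * x ^ n := by
    have : 0 < a * ξ * x ^ n := by positivity
    linarith
  have hs : 1 - muf a n x * (1 + ξ * x ^ n) = x ^ n * (a - ξ + a * ξ * x ^ n) := by
    unfold muf
    ring
  have e1 : (x ^ n) ^ ((2 : ℝ) / 3) = x ^ (n - 1) * x ^ (1 - (n : ℝ) / 3) := by
    rw [← Real.rpow_natCast, ← Real.rpow_natCast, ← Real.rpow_mul hx.le, ← Real.rpow_add hx,
      Nat.cast_sub (Nat.one_le_iff_ne_zero.2 hn)]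
    congr 1
    push_cast
    ring
  have e2 : x * (x ^ n) ^ (-(1 : ℝ) / 3) = x ^ (1 - (n : ℝ) / 3) := by
    rw [← Real.rpow_natCast, ← Real.rpow_mul hx.le]
    nth_rw 1 [← Real.rpow_one x]
    rw [← Real.rpow_add hx]
    congr 1
    ring
  unfold nullField scaledSlope
  rw [hs, Real.mul_rpow (by positivity) hw.le, Real.mul_rpow (by positivity) hw.le, e1, ← e2]
  ring

theorem continuousAt_scaledSlope {a ξ : ℝ} {n : ℕ} (hn : n ≠ 0) (hn3 : n ≤ 3) (hξa : ξ < a) :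
    ContinuousAt (scaledSlope a ξ n) 0 := by
  have hβ : 0 ≤ 1 - (n : ℝ) / 3 := by
    have : (n : ℝ) ≤ 3 := by exact_mod_cast hn3
    linarith
  have h0 : ContinuousAt (fun x : ℝ => x ^ (1 - (n : ℝ) / 3)) 0 :=
    Real.continuousAt_rpow_const _ _ (Or.inr hβ)
  have h : ∀ c : ℝ, ContinuousAt (fun x : ℝ => (a - ξ + a * ξ * x ^ n) ^ c) 0 := fun c =>
    ContinuousAt.rpow_const (by fun_prop) (Or.inl (by simp [hn]; linarith))
  have h1 := h (2 / 3)
  have h2 := h (-1 / 3)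
  unfold scaledSlope
  fun_prop

theorem scaledSlope_zero_of_lt_three {a ξ : ℝ} {n : ℕ} (hn3 : n < 3) :
    scaledSlope a ξ n 0 = 0 := by
  have hβ : 1 - (n : ℝ) / 3 ≠ 0 := by
    have : (n : ℝ) < 3 := by exact_mod_cast hn3
    linarith
  rw [scaledSlope, Real.zero_rpow hβ, zero_mul]

theorem two_thirds_rpow_eq : (2 / 3 : ℝ) ^ ((3 : ℝ) / 2) = 2 / 3 * √(2 / 3) := by
  rw [show (3 : ℝ) / 2 = 1 + 1 / 2 by norm_num, Real.rpow_add (by norm_num), Real.rpow_one,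
    Real.sqrt_eq_rpow]

/-- Choice of the slope of the lower barrier in the naked case. -/
theorem exists_lower_slope {n : ℕ} {a : ℝ} (ha : 0 < a)
    (hcase : n = 1 ∨ n = 2 ∨ (n = 3 ∧ a > 2 * (26 + 15 * √3) / 27)) :
    ∃ ξ, 0 < ξ ∧ ξ < a ∧ scaledSlope a ξ n 0 < n * ξ ∧
      (2 / 3 : ℝ) ^ ((3 : ℝ) / 2) * 0 ^ (3 - n) < a - ξ := by
  have easy : n = 1 ∨ n = 2 → ∃ ξ, 0 < ξ ∧ ξ < a ∧ scaledSlope a ξ n 0 < n * ξ ∧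
      (2 / 3 : ℝ) ^ ((3 : ℝ) / 2) * 0 ^ (3 - n) < a - ξ := by
    intro h
    have hn0 : 0 < n := by lia
    have hn : (0 : ℝ) < n := by exact_mod_cast hn0
    refine ⟨a / 2, by positivity, by linarith, ?_, ?_⟩
    · rw [scaledSlope_zero_of_lt_three (by lia)]
      positivity
    · rw [zero_pow (by lia)]
      linarith
  rcases hcase with h | h | ⟨rfl, h⟩
  · exact easy (Or.inl h)
  · exact easy (Or.inr h)
  have h3 : √3 ^ 2 = 3 := Real.sq_sqrt (by norm_num)
  have h3' : 1.7 < √3 := Real.lt_sqrt_of_sq_lt (by norm_num)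
  set y : ℝ := (1 + √3) / 3 with hy
  have hy0 : 0 < y := by positivity
  have hyc : y ^ 3 = (10 + 6 * √3) / 27 := by
    rw [hy]
    linear_combination (√3 + 3) / 27 * h3
  have hya : y ^ 3 < a := by rw [hyc]; linarith
  refine ⟨a - y ^ 3, by linarith, by linarith [pow_pos hy0 3], ?_, ?_⟩
  · have e : scaledSlope a (a - y ^ 3) 3 0 = y ^ 2 + 2 * a * y⁻¹ := by
      simp only [scaledSlope]
      norm_num
      rw [cube_rpow_two_thirds hy0.le,
        show (-(1 / 3) : ℝ) = -1 / 3 by norm_num, cube_rpow_neg_third hy0.le]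
      ring
    rw [e]
    have hmul : y * (y ^ 2 + 2 * a * y⁻¹) < y * (3 * (a - y ^ 3)) := by
      have : y * (y ^ 2 + 2 * a * y⁻¹) = y ^ 3 + 2 * a := by field_simp
      rw [this]
      have hpos : 0 < (√3 - 1) * (a - 2 * (26 + 15 * √3) / 27) :=
        mul_pos (by linarith) (by linarith)
      have : y * (3 * (a - y ^ 3)) - (y ^ 3 + 2 * a) =
          (√3 - 1) * (a - 2 * (26 + 15 * √3) / 27) := by
        rw [hyc, hy]
        ring_nf
        rw [h3]
        ring
      linarith
    push_cast
    exact lt_of_mul_lt_mul_left hmul hy0.le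
  · have hr : √(2 / 3) < 0.82 := (Real.sqrt_lt' (by norm_num)).2 (by norm_num)
    rw [two_thirds_rpow_eq, Nat.sub_self, pow_zero, mul_one, sub_sub_cancel, hyc]
    linarith

theorem lower_le_t0f {a ξ : ℝ} {n : ℕ} {x : ℝ} (hn3 : n ≤ 3) (ha : 0 < a) (hx : 0 < x)
    (hμ : 0 < muf a n x) (h : (2 / 3 : ℝ) ^ ((3 : ℝ) / 2) * x ^ (3 - n) < a - ξ) :
    1 + ξ * x ^ n ≤ t0f a n x := by
  have hκ : 0 < (2 / 3 : ℝ) ^ ((3 : ℝ) / 2) := by positivity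
  set κ := (2 / 3 : ℝ) ^ ((3 : ℝ) / 2) with hκdef
  have hu : 0 < a * x ^ n := by positivity
  have hμ1 : muf a n x ≤ 1 := by unfold muf; linarith
  have e : t0f a n x = 1 / muf a n x - κ * muf a n x ^ 2 * x ^ 3 := by
    unfold t0f
    rw [← hκdef]
    field_simp
  have h1 : 1 + a * x ^ n ≤ 1 / muf a n x := by
    rw [le_div_iff₀ hμ]
    unfold muf
    nlinarith
  have h2 : κ * muf a n x ^ 2 * x ^ 3 ≤ κ * 1 * x ^ 3 := by
    gcongr
    exact pow_le_one₀ hμ.le hμ1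
  have h3 : κ * x ^ (3 - n) * x ^ n ≤ (a - ξ) * x ^ n := by gcongr
  rw [mul_assoc, ← pow_add, Nat.sub_add_cancel hn3] at h3
  rw [e]
  linarith

theorem t0f_le_thf {a : ℝ} {n : ℕ} {x : ℝ} (hx : 0 < x) (hμ : 0 < muf a n x) :
    t0f a n x ≤ thf a n x := by
  have hκ : (8 / 27 : ℝ) ≤ (2 / 3 : ℝ) ^ ((3 : ℝ) / 2) := by
    rw [two_thirds_rpow_eq]
    have : (2 / 3 : ℝ) < √(2 / 3) := Real.lt_sqrt_of_sq_lt (by norm_num)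
    linarith
  unfold t0f thf
  gcongr

open Set Filter Topology in
theorem tendsto_thf {a : ℝ} {n : ℕ} (hn : n ≠ 0) : Tendsto (thf a n) (𝓝[>] 0) (𝓝 1) := by
  have h0 : muf a n 0 = 1 := by simp [muf, hn]
  have hc := (hasDerivAt_thf (a := a) (n := n) (x := 0) (by simp [h0])).continuousAt
  have h1 : thf a n 0 = 1 := by simp [thf, h0]
  simpa [ContinuousAt, h1] using hc.mono_left nhdsWithin_le_nhds

/-- First half of Theorem 4.1 (naked case): for `n ∈ {1,2}`, or `n = 3` with
`a > 2(26+15√3)/27`, the photon surface extension — the outgoing radial null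
geodesic through `(t₀(x_b), x_b)` — extends back on all of `(0, x_b]`, is
squeezed between the supersolution `1 + ξ xⁿ` and the apparent horizon `t_h`,
and reaches the central singularity: `t(x) → 1` as `x → 0⁺`. -/
theorem stmt_15 (n : ℕ) (a : ℝ) (ha : 0 < a)
    (hcase : n = 1 ∨ n = 2 ∨ (n = 3 ∧ a > 2 * (26 + 15 * Real.sqrt 3) / 27)) :
    ∃ ξ : ℝ, 0 < ξ ∧ ξ < a ∧ ∃ xbar > (0 : ℝ), ∀ xb : ℝ, 0 < xb → xb ≤ xbar →
      ∃ t : ℝ → ℝ, t xb = t0f a n xb ∧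
        (∀ x : ℝ, 0 < x → x ≤ xb →
          HasDerivWithinAt t (deriv (fun x' => rf a n (t x) x') x) (Set.Ioc 0 xb) x ∧
          1 + ξ * x ^ n ≤ t x ∧ t x ≤ thf a n x) ∧
        Filter.Tendsto t (nhdsWithin 0 (Set.Ioi 0)) (nhds 1) := by
  have hn : n ≠ 0 := by lia
  have hn3 : n ≤ 3 := by lia
  obtain ⟨ξ, hξ, hξa, hslope, hstart⟩ := exists_lower_slope ha hcase
  refine ⟨ξ, hξ, hξa, ?_⟩
  have hμc := continuous_muf a n
  have hμ0 : muf a n 0 = 1 := by simp [muf, hn]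
  have ev : ∀ᶠ x in nhds (0 : ℝ), scaledSlope a ξ n x < n * ξ ∧
      (2 / 3 : ℝ) ^ ((3 : ℝ) / 2) * x ^ (3 - n) < a - ξ ∧ 0 < muf a n x ∧
      2 * a * n * (x * x ^ (n - 1)) < 3 * muf a n x := by
    have hc : ContinuousAt (fun x : ℝ => (2 / 3 : ℝ) ^ ((3 : ℝ) / 2) * x ^ (3 - n)) 0 := by
      fun_prop
    have hc' : ContinuousAt (fun x : ℝ => 2 * a * n * (x * x ^ (n - 1))) 0 := by fun_prop
    have hc'' : ContinuousAt (fun x : ℝ => 3 * muf a n x) 0 := by fun_prop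
    exact ((continuousAt_scaledSlope hn hn3 hξa).eventually_lt continuousAt_const hslope).and
      ((hc.eventually_lt continuousAt_const hstart).and
        ((continuousAt_const.eventually_lt hμc.continuousAt (by simp [hμ0])).and
          (hc'.eventually_lt hc'' (by simp [hμ0]))))
  obtain ⟨δ, hδ, hball⟩ := Metric.eventually_nhds_iff.1 ev
  refine ⟨δ / 2, by positivity, fun xb hxb hxbδ => ?_⟩
  have hsmall : ∀ x ∈ Set.Ioc 0 xb, scaledSlope a ξ n x < n * ξ ∧
      (2 / 3 : ℝ) ^ ((3 : ℝ) / 2) * x ^ (3 - n) < a - ξ ∧ 0 < muf a n x ∧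
      2 * a * n * (x * x ^ (n - 1)) < 3 * muf a n x := fun x hx => hball (by
    rw [Real.dist_eq, sub_zero, abs_of_pos hx.1]
    linarith [hx.2])
  have hs : ∀ x ∈ Set.Ioc 0 xb, ∀ p ∈ Set.Icc (1 + ξ * x ^ n) (thf a n x),
      0 < 1 - muf a n x * p := fun x hx p hp =>
    one_sub_muf_mul_pos hx.1 (hsmall x hx).2.2.1 hp.2
  have hlow : ∀ x ∈ Set.Ioc 0 xb, 1 + ξ * x ^ n ≤ t0f a n x := fun x hx =>
    lower_le_t0f hn3 ha hx.1 (hsmall x hx).2.2.1 (hsmall x hx).2.1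
  have hupp : ∀ x ∈ Set.Ioc 0 xb, t0f a n x ≤ thf a n x := fun x hx =>
    t0f_le_thf hx.1 (hsmall x hx).2.2.1
  have hb : xb ∈ Set.Ioc 0 xb := ⟨hxb, le_rfl⟩
  obtain ⟨t, htb, ht⟩ := exists_solution_between_barriers_Ioc (f := nullField a n)
    (f' := nullFieldDeriv a n) (L := fun x => 1 + ξ * x ^ n) (U := thf a n)
    (L' := fun x => ξ * (n * x ^ (n - 1))) (U' := thfDeriv a n) (b := xb) (t₀ := t0f a n xb)
    (fun x _ => ((hasDerivAt_pow n x).const_mul ξ).const_add 1)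
    (fun x hx => hasDerivAt_thf (hsmall x hx).2.2.1)
    (fun x hx => (hlow x hx).trans (hupp x hx))
    (fun x hx p hp => hasDerivAt_nullField (hs x hx p hp))
    (fun x hx p hp => continuousAt_nullField (hs x hx p hp))
    (fun x hx p hp => continuousAt_nullFieldDeriv (hs x hx p hp))
    (fun x hx => by
      rw [nullField_lower hn hx.1 hξ hξa]
      calc x ^ (n - 1) * scaledSlope a ξ n x < x ^ (n - 1) * (n * ξ) :=
            mul_lt_mul_of_pos_left (hsmall x hx).1 (pow_pos hx.1 _)
        _ = ξ * (n * x ^ (n - 1)) := by ring)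
    (fun x hx => thfDeriv_lt_nullField hx.1 (hsmall x hx).2.2.1 (hsmall x hx).2.2.2)
    hxb ⟨hlow xb hb, hupp xb hb⟩
  refine ⟨t, htb, fun x hx hxb' => ?_, ?_⟩
  · obtain ⟨h1, h2⟩ := ht x ⟨hx, hxb'⟩
    rw [deriv_rf (hs x ⟨hx, hxb'⟩ _ h2)]
    exact ⟨h1, h2⟩
  · refine tendsto_of_tendsto_of_tendsto_of_le_of_le' tendsto_const_nhds
      (tendsto_thf (a := a) hn) ?_ ?_
    · filter_upwards [Ioc_mem_nhdsGT hxb] with x hx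
      have : 0 < ξ * x ^ n := mul_pos hξ (pow_pos hx.1 n)
      linarith [(ht x hx).2.1]
    · filter_upwards [Ioc_mem_nhdsGT hxb] with x hx
      exact (ht x hx).2.2
end
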